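/- arXiv:1811.04410 — 4 statements merged into one kernel-verified Lean document; each statement's English description precedes it below -/
import Mathlib

section
/- Let n ≥ 3 and 0 < m < (n-2)/n. Then: (a) if A_1(m,β) = 0 for some β ≥ β_0(m), then β = β_1(m) and m ≥ (n-4)/(n-2); (b) if n > 4 and 0 < m < (n-4)/(n-2), then A_1(m,β_1(m)) > 0 and A_2(m,β_1(m)) = 0; (c) if n > 4 and m = (n-4)/(n-2), then A_1(m,β_1(m)) = 0 and A_2(m,β_1(m)) = 0; (d) if max((n-4)/(n-2), 0) < m < (n-2)/n, then A_1(m,β_1(m)) = 0 and A_2(m,β_1(m)) < 0. -/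
open Real Filter MeasureTheory Set Topology

noncomputable section

def Cstar (n : ℕ) (m : ℝ) : ℝ := 2 * m * ((n : ℝ) - 2 - n * m) / (1 - m)

def beta1 (n : ℕ) (m : ℝ) : ℝ := 1 / ((n : ℝ) - 2 - n * m)

def betaE (n : ℕ) (m : ℝ) : ℝ := m / ((n : ℝ) - 2 - n * m)

def beta2 (n : ℕ) (m : ℝ) : ℝ :=
  Real.sqrt (2 * (1 - m) / ((n : ℝ) - 2 - n * m)) +
    (((n : ℝ) + 2) * m - ((n : ℝ) - 2)) / (2 * ((n : ℝ) - 2 - n * m))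

def beta0 (n : ℕ) (m : ℝ) : ℝ := max (beta2 n m) (betaE n m)

def A0 (n : ℕ) (m β : ℝ) : ℝ :=
  (n : ℝ) - 2 - ((n : ℝ) + 2) * m + 2 * β * ((n : ℝ) - 2 - n * m)

def gamma1 (n : ℕ) (m β : ℝ) : ℝ :=
  (A0 n m β - Real.sqrt ((A0 n m β) ^ 2 - 8 * ((n : ℝ) - 2 - n * m) * (1 - m))) / (2 * (1 - m))

def gamma2 (n : ℕ) (m β : ℝ) : ℝ :=
  (A0 n m β + Real.sqrt ((A0 n m β) ^ 2 - 8 * ((n : ℝ) - 2 - n * m) * (1 - m))) / (2 * (1 - m))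

def Acoef1 (n : ℕ) (m β : ℝ) : ℝ := 1 / (1 - m) - β * gamma1 n m β

def Acoef2 (n : ℕ) (m β : ℝ) : ℝ := 1 / (1 - m) - β * gamma2 n m β

/-- Condition (C1). -/
def CondC1 (n : ℕ) (m β : ℝ) : Prop :=
  beta1 n m < β ∨
    (4 < n ∧ 0 < m ∧ m < ((n : ℝ) - 4) / ((n : ℝ) - 2) ∧ beta0 n m < β ∧ β ≤ beta1 n m)

/-- Condition (C2). -/
def CondC2 (n : ℕ) (m β : ℝ) : Prop :=
  beta0 n m < β ∧ β < beta1 n m ∧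
    (n ≤ 4 ∨ (4 < n ∧ ((n : ℝ) - 4) / ((n : ℝ) - 2) < m ∧ m < ((n : ℝ) - 2) / n))

/-- Condition (C3). -/
def CondC3 (n : ℕ) (m β : ℝ) : Prop :=
  β = beta1 n m ∧
    (n ≤ 4 ∨ (4 < n ∧ ((n : ℝ) - 4) / ((n : ℝ) - 2) < m ∧ m < ((n : ℝ) - 2) / n))

/-- A self-similar profile `f = f_lam`. -/
structure IsProfile (n : ℕ) (m β α lam : ℝ) (f : ℝ → ℝ) : Prop where
  pos : ∀ r, 0 ≤ r → 0 < f r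
  smooth : ContDiffOn ℝ 2 f (Set.Ici 0)
  ode : ∀ r, 0 < r →
    deriv (deriv (fun s => f s ^ m)) r + (((n : ℝ) - 1) / r) * deriv (fun s => f s ^ m) r +
      α * f r + β * r * deriv f r = 0
  init : f 0 = lam ^ (2 / (1 - m))
  init' : deriv f 0 = 0
  asymp : Tendsto (fun r => r ^ 2 * f r ^ (1 - m)) atTop (nhds (Cstar n m))

/-- The Laplacian of `f : ℝ^n → ℝ`. -/
def lap (n : ℕ) (f : EuclideanSpace ℝ (Fin n) → ℝ) (x : EuclideanSpace ℝ (Fin n)) : ℝ :=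
  ∑ i : Fin n,
    fderiv ℝ (fun y => fderiv ℝ f y (EuclideanSpace.single i (1 : ℝ))) x
      (EuclideanSpace.single i (1 : ℝ))

/-- The self-similar solution `U_lam(x,t) = (T-t)^α f_lam((T-t)^β |x|)`. -/
def Uself (n : ℕ) (β α T : ℝ) (f : ℝ → ℝ) (x : EuclideanSpace ℝ (Fin n)) (t : ℝ) : ℝ :=
  (T - t) ^ α * f ((T - t) ^ β * ‖x‖)

/-- A (positive smooth) solution of the Cauchy problem `u_t = Δ(u^m)` on `ℝ^n × (0,T)` with
initial value `u0` taken in `L¹_loc`. -/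
structure IsCauchySolution (n : ℕ) (m T : ℝ) (u0 : EuclideanSpace ℝ (Fin n) → ℝ)
    (u : EuclideanSpace ℝ (Fin n) → ℝ → ℝ) : Prop where
  pos : ∀ x, ∀ t ∈ Set.Ioo 0 T, 0 < u x t
  smooth : ContDiffOn ℝ (⊤ : ℕ∞) (fun p : EuclideanSpace ℝ (Fin n) × ℝ => u p.1 p.2)
    ((Set.univ : Set (EuclideanSpace ℝ (Fin n))) ×ˢ Set.Ioo 0 T)
  pde : ∀ x, ∀ t ∈ Set.Ioo 0 T, deriv (u x) t = lap n (fun y => u y t ^ m) x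
  init : ∀ K : Set (EuclideanSpace ℝ (Fin n)), IsCompact K →
    Tendsto (fun t => ∫ x in K, |u x t - u0 x|) (nhdsWithin 0 (Set.Ioi 0)) (nhds 0)

/-- The rescaled solution `ũ(y,τ)`. -/
def resc (n : ℕ) (β α T : ℝ) (u : EuclideanSpace ℝ (Fin n) → ℝ → ℝ)
    (y : EuclideanSpace ℝ (Fin n)) (τ : ℝ) : ℝ :=
  (T * Real.exp (-τ)) ^ (-α) * u (((T * Real.exp (-τ)) ^ (-β)) • y) (T * (1 - Real.exp (-τ)))

/-- The singular profile `𝒞(y) = (C_*/|y|²)^{1/(1-m)}`. -/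
def singC (n : ℕ) (m : ℝ) (y : EuclideanSpace ℝ (Fin n)) : ℝ :=
  (Cstar n m / ‖y‖ ^ 2) ^ (1 / (1 - m))

/-- The weight exponent `p₀`. -/
def pZero (n : ℕ) (m β : ℝ) : ℝ := ((1 - m) / 2) * ((n : ℝ) - 2 / (1 - m) - gamma1 n m β)

/-- The constant `a_*`. -/
def aStar (n : ℕ) (m β : ℝ) : ℝ :=
  2 * m * pZero n m β / (Cstar n m * (1 - m)) * (gamma1 n m β + 2 * m / (1 - m))

/-- `Φ(s) = (1+w(s))^{1/m} − 1 − w(s)/m`. -/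
def Phi (m : ℝ) (w : ℝ → ℝ) (s : ℝ) : ℝ := (1 + w s) ^ (1 / m) - 1 - w s / m

end

lemma A0_beta1 (n : ℕ) (m : ℝ) (hD : (n : ℝ) - 2 - n * m ≠ 0) :
    A0 n m (beta1 n m) = n - (n + 2) * m := by
  unfold A0 beta1
  generalize hd : (n : ℝ) - 2 - n * m = D at hD
  field_simp
  linarith

lemma sqrt_discrim_beta1 (n : ℕ) (m : ℝ) (hD : (n : ℝ) - 2 - n * m ≠ 0) :
    Real.sqrt ((A0 n m (beta1 n m)) ^ 2 - 8 * ((n : ℝ) - 2 - n * m) * (1 - m)) =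
      |(n : ℝ) - 4 - (n - 2) * m| := by
  rw [A0_beta1 n m hD, ← Real.sqrt_sq_eq_abs]
  ring_nf

/-- The values at `β₁` when `m (n - 2) ≤ n - 4`. -/
lemma Acoef_beta1_of_le (n : ℕ) (m : ℝ) (hD : (n : ℝ) - 2 - n * m ≠ 0) (hk : 1 - m ≠ 0)
    (h : 0 ≤ (n : ℝ) - 4 - (n - 2) * m) :
    Acoef1 n m (beta1 n m) =
        ((n : ℝ) - 4 - (n - 2) * m) / ((1 - m) * (n - 2 - n * m)) ∧
      Acoef2 n m (beta1 n m) = 0 := by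
  unfold Acoef1 Acoef2 gamma1 gamma2
  rw [sqrt_discrim_beta1 n m hD, A0_beta1 n m hD, abs_of_nonneg h, beta1]
  generalize hd : (n : ℝ) - 2 - n * m = D at hD
  constructor
  · field_simp
    linarith
  · field_simp
    linarith

/-- The values at `β₁` when `n - 4 ≤ m (n - 2)`. -/
lemma Acoef_beta1_of_ge (n : ℕ) (m : ℝ) (hD : (n : ℝ) - 2 - n * m ≠ 0) (hk : 1 - m ≠ 0)
    (h : (n : ℝ) - 4 - (n - 2) * m ≤ 0) :
    Acoef1 n m (beta1 n m) = 0 ∧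
      Acoef2 n m (beta1 n m) =
        ((n : ℝ) - 4 - (n - 2) * m) / ((1 - m) * (n - 2 - n * m)) := by
  unfold Acoef1 Acoef2 gamma1 gamma2
  rw [sqrt_discrim_beta1 n m hD, A0_beta1 n m hD, abs_of_nonpos h, beta1]
  generalize hd : (n : ℝ) - 2 - n * m = D at hD
  constructor
  · field_simp
    linarith
  · field_simp
    linarith

lemma discrim_nonneg_of_beta2_le (n : ℕ) (m β : ℝ) (hD : 0 < (n : ℝ) - 2 - n * m)
    (hk : 0 < 1 - m) (hβ : beta2 n m ≤ β) :
    0 ≤ (A0 n m β) ^ 2 - 8 * ((n : ℝ) - 2 - n * m) * (1 - m) := by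
  unfold beta2 at hβ
  set s := Real.sqrt (2 * (1 - m) / ((n : ℝ) - 2 - n * m)) with hs
  have hs0 : 0 ≤ s := Real.sqrt_nonneg _
  have hs2 : s ^ 2 * ((n : ℝ) - 2 - n * m) = 2 * (1 - m) := by
    rw [hs, Real.sq_sqrt (by positivity), div_mul_cancel₀ _ hD.ne']
  have hle : 2 * ((n : ℝ) - 2 - n * m) * s ≤ A0 n m β := by
    have h := mul_le_mul_of_nonneg_left hβ (by positivity : 0 ≤ 2 * ((n : ℝ) - 2 - n * m))
    rw [mul_add, mul_div_cancel₀ _ (by positivity)] at h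
    unfold A0
    linarith
  have hsq := pow_le_pow_left₀ (by positivity) hle 2
  have heq : (2 * ((n : ℝ) - 2 - n * m) * s) ^ 2 = 8 * ((n : ℝ) - 2 - n * m) * (1 - m) := by
    linear_combination 4 * ((n : ℝ) - 2 - n * m) * hs2
  linarith

/-- `γ₁` is a root of the characteristic equation. -/
lemma gamma1_root (n : ℕ) (m β : ℝ) (hk : 1 - m ≠ 0)
    (h : 0 ≤ (A0 n m β) ^ 2 - 8 * ((n : ℝ) - 2 - n * m) * (1 - m)) :
    (1 - m) * gamma1 n m β ^ 2 - A0 n m β * gamma1 n m β + 2 * ((n : ℝ) - 2 - n * m) = 0 := by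
  have hs := Real.sq_sqrt h
  unfold gamma1
  set s := Real.sqrt ((A0 n m β) ^ 2 - 8 * ((n : ℝ) - 2 - n * m) * (1 - m))
  field_simp
  linear_combination hs

lemma eq_beta1_of_Acoef1_eq_zero (n : ℕ) (m β : ℝ) (hm : 0 < m)
    (hD : 0 < (n : ℝ) - 2 - n * m) (hk : 0 < 1 - m) (hβ : beta0 n m ≤ β)
    (h : Acoef1 n m β = 0) : β = beta1 n m := by
  have hβ0 : 0 < β := (div_pos hm hD).trans_le ((le_max_right _ _).trans hβ)
  have hroot := gamma1_root n m β hk.ne'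
    (discrim_nonneg_of_beta2_le n m β hD hk ((le_max_left _ _).trans hβ))
  have hg : (1 - m) * (β * gamma1 n m β) = 1 := by
    unfold Acoef1 at h
    rw [← sub_eq_zero.mp h]
    field_simp
  have hfac : (1 - ((n : ℝ) - 2 - n * m) * β) * (1 + 2 * m * β) = 0 := by
    unfold A0 at hroot
    linear_combination (1 - m) * β ^ 2 * hroot -
      ((1 - m) * (β * gamma1 n m β) + 1 -
        β * ((n : ℝ) - 2 - (n + 2) * m + 2 * β * (n - 2 - n * m))) * hg
  have hne : 1 + 2 * m * β ≠ 0 := by positivity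
  have h1 := (mul_eq_zero.mp hfac).resolve_right hne
  rw [beta1, eq_div_iff hD.ne']
  linarith

/-- Sign properties of `A₁(m,β)` and `A₂(m,β)` at `β = β₁(m)`. -/
theorem Acoef_at_beta1 (n : ℕ) (m : ℝ) (hn : 3 ≤ n) (hm0 : 0 < m)
    (hm1 : m < ((n : ℝ) - 2) / n) :
    (∀ β : ℝ, beta0 n m ≤ β → Acoef1 n m β = 0 →
      β = beta1 n m ∧ ((n : ℝ) - 4) / ((n : ℝ) - 2) ≤ m) ∧
    (4 < n → m < ((n : ℝ) - 4) / ((n : ℝ) - 2) →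
      0 < Acoef1 n m (beta1 n m) ∧ Acoef2 n m (beta1 n m) = 0) ∧
    (4 < n → m = ((n : ℝ) - 4) / ((n : ℝ) - 2) →
      Acoef1 n m (beta1 n m) = 0 ∧ Acoef2 n m (beta1 n m) = 0) ∧
    (max (((n : ℝ) - 4) / ((n : ℝ) - 2)) 0 < m →
      Acoef1 n m (beta1 n m) = 0 ∧ Acoef2 n m (beta1 n m) < 0) := by
  have hn3 : (3 : ℝ) ≤ n := by exact_mod_cast hn
  have hn2 : (0 : ℝ) < n - 2 := by linarith
  have hD : 0 < (n : ℝ) - 2 - n * m := by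
    rw [lt_div_iff₀ (by linarith)] at hm1
    linarith
  have hk : 0 < 1 - m := by
    by_contra! hk
    nlinarith
  refine ⟨fun β hβ h => ?_, fun _ hm => ?_, fun _ hm => ?_, fun hm => ?_⟩
  · have hβ1 := eq_beta1_of_Acoef1_eq_zero n m β hm0 hD hk hβ h
    refine ⟨hβ1, ?_⟩
    by_contra! hlt
    rw [lt_div_iff₀ hn2] at hlt
    have hpos : 0 < (n : ℝ) - 4 - (n - 2) * m := by linarith
    rw [hβ1, (Acoef_beta1_of_le n m hD.ne' hk.ne' hpos.le).1] at h
    exact (div_pos hpos (mul_pos hk hD)).ne' h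
  · rw [lt_div_iff₀ hn2] at hm
    have hpos : 0 < (n : ℝ) - 4 - (n - 2) * m := by linarith
    obtain ⟨h1, h2⟩ := Acoef_beta1_of_le n m hD.ne' hk.ne' hpos.le
    exact ⟨h1 ▸ div_pos hpos (mul_pos hk hD), h2⟩
  · rw [eq_div_iff hn2.ne'] at hm
    exact ⟨(Acoef_beta1_of_ge n m hD.ne' hk.ne' (by linarith)).1,
      (Acoef_beta1_of_le n m hD.ne' hk.ne' (by linarith)).2⟩
  · have hlt := (le_max_left _ _).trans_lt hm
    rw [div_lt_iff₀ hn2] at hlt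
    have hneg : (n : ℝ) - 4 - (n - 2) * m < 0 := by linarith
    obtain ⟨h1, h2⟩ := Acoef_beta1_of_ge n m hD.ne' hk.ne' hneg.le
    exact ⟨h1, h2 ▸ div_neg_of_neg_of_pos hneg (mul_pos hk hD)⟩
end

section
/- Let n ≥ 3 and 0 < m < (n-2)/n. Then: (a) if condition (C1) holds, then A_1(m,β) > 0; (b) if condition (C2) holds, then A_1(m,β) < 0; (c) if condition (C3) holds, then A_1(m,β) = 0 and A_2(m,β) < 0. -/
open Real Filter MeasureTheory Set Topology

theorem Acoef1_eq (n : ℕ) {m : ℝ} (β : ℝ) (hm : m < 1) :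
    Acoef1 n m β = (2 - A0 n m β * β +
      β * √((A0 n m β) ^ 2 - 8 * ((n : ℝ) - 2 - n * m) * (1 - m))) / (2 * (1 - m)) := by
  have h : 1 - m ≠ 0 := by linarith
  unfold Acoef1 gamma1
  field_simp
  ring

theorem Acoef2_eq (n : ℕ) {m : ℝ} (β : ℝ) (hm : m < 1) :
    Acoef2 n m β = (2 - A0 n m β * β -
      β * √((A0 n m β) ^ 2 - 8 * ((n : ℝ) - 2 - n * m) * (1 - m))) / (2 * (1 - m)) := by
  have h : 1 - m ≠ 0 := by linarith
  unfold Acoef2 gamma2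
  field_simp
  ring

/-- The characteristic polynomial at `1 / ((1 - m) β)` factors, with a root at `β = β₁`. -/
theorem two_sub_A0_mul_sq (n : ℕ) (m β : ℝ) :
    (2 - A0 n m β * β) ^ 2 =
      β ^ 2 * ((A0 n m β) ^ 2 - 8 * ((n : ℝ) - 2 - n * m) * (1 - m)) +
        4 * ((1 - ((n : ℝ) - 2 - n * m) * β) * (1 + 2 * m * β)) := by
  unfold A0
  ring

theorem sqrt_lt_A0 {n : ℕ} {m β : ℝ} (hk : 0 < (n : ℝ) - 2 - n * m)
    (hβ : beta2 n m < β) :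
    2 * √(2 * ((n : ℝ) - 2 - n * m) * (1 - m)) < A0 n m β := by
  unfold beta2 at hβ
  unfold A0
  set k : ℝ := (n : ℝ) - 2 - n * m with hk_def
  have hs : √(2 * k * (1 - m)) = k * √(2 * (1 - m) / k) := by
    rw [show 2 * k * (1 - m) = k ^ 2 * (2 * (1 - m) / k) by field_simp,
      Real.sqrt_mul (sq_nonneg k), Real.sqrt_sq hk.le]
  have h := mul_lt_mul_of_pos_left hβ (mul_pos two_pos hk)
  have hd : 2 * k * ((((n : ℝ) + 2) * m - ((n : ℝ) - 2)) / (2 * k)) =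
      ((n : ℝ) + 2) * m - ((n : ℝ) - 2) := by field_simp
  rw [hs]
  linarith

/-- The vertex of the characteristic parabola lies to the right of `1 / ((1 - m) β)`. -/
theorem two_lt_A0_mul {n : ℕ} {m β : ℝ} (hm0 : 0 < m) (hm1 : m < 1) (hβ0 : 0 < β)
    (hk : 0 < (n : ℝ) - 2 - n * m) (hkq : (n : ℝ) - 2 - n * m < 2 * (1 - m))
    (hβ : beta2 n m < β) : 2 < A0 n m β * β := by
  have hA := sqrt_lt_A0 hk hβ
  have hAk : A0 n m β = (n - 2 - n * m) - 2 * m + 2 * ((n - 2 - n * m) * β) := by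
    unfold A0
    ring
  set k : ℝ := (n : ℝ) - 2 - n * m
  set s := √(2 * k * (1 - m))
  have hs2 : s ^ 2 = 2 * k * (1 - m) := Real.sq_sqrt (by nlinarith)
  have hs : 0 < s := Real.sqrt_pos.2 (by nlinarith)
  by_contra! hle
  have hsβ : s * β < 1 := by nlinarith
  have hsq : s < 2 * (1 - m) := by nlinarith
  have hkβ : k * β * (2 * (1 - m)) < s := by nlinarith
  have hks : k * (2 * (1 - m)) = s ^ 2 := by linarith
  have h := mul_lt_mul_of_pos_right hA (show 0 < 2 * (1 - m) by linarith)
  rw [hAk] at h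
  nlinarith [mul_pos hm0 (sub_pos.2 hsq), mul_pos hs (sub_pos.2 hsq)]

theorem lt_two_mul_one_sub {n : ℕ} {m : ℝ} (hn : 3 ≤ n) (hm0 : 0 < m)
    (h : n ≤ 4 ∨ (4 < n ∧ ((n : ℝ) - 4) / ((n : ℝ) - 2) < m ∧ m < ((n : ℝ) - 2) / n)) :
    (n : ℝ) - 2 - n * m < 2 * (1 - m) := by
  have hn' : (3 : ℝ) ≤ n := by exact_mod_cast hn
  rcases h with h | ⟨-, h, -⟩
  · have h4 : (n : ℝ) ≤ 4 := by exact_mod_cast h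
    nlinarith
  · rw [div_lt_iff₀ (by linarith)] at h
    linarith

/-- Sign of `A₁(m,β)` (and `A₂(m,β)`) under the conditions (C1), (C2), (C3). -/
theorem Acoef_sign_conditions (n : ℕ) (m β : ℝ) (hn : 3 ≤ n) (hm0 : 0 < m)
    (hm1 : m < ((n : ℝ) - 2) / n) :
    (CondC1 n m β → 0 < Acoef1 n m β) ∧
    (CondC2 n m β → Acoef1 n m β < 0) ∧
    (CondC3 n m β → Acoef1 n m β = 0 ∧ Acoef2 n m β < 0) := by
  have hn' : (3 : ℝ) ≤ n := by exact_mod_cast hn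
  have hk : 0 < (n : ℝ) - 2 - n * m := by
    rw [lt_div_iff₀ (by linarith)] at hm1
    linarith
  have hm : m < 1 := hm1.trans (by rw [div_lt_one (by linarith)]; linarith)
  have hq : 0 < 2 * (1 - m) := by linarith
  have hβ1 : 0 < beta1 n m := one_div_pos.2 hk
  have hβe : 0 < betaE n m := div_pos hm0 hk
  have hfac := two_sub_A0_mul_sq n m β
  rw [Acoef1_eq n β hm, Acoef2_eq n β hm]
  have hAk : A0 n m β = (n - 2 - n * m) - 2 * m + 2 * ((n - 2 - n * m) * β) := by
    unfold A0
    ring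
  refine ⟨?_, ?_, ?_⟩
  · rintro (h | ⟨h4, -, hmn, hβ0, hβ⟩)
    · have hβ : 0 < β := hβ1.trans h
      rw [beta1, div_lt_iff₀ hk] at h
      refine div_pos ?_ hq
      have hneg : (1 - ((n : ℝ) - 2 - n * m) * β) * (1 + 2 * m * β) < 0 :=
        mul_neg_of_neg_of_pos (by linarith) (by positivity)
      rw [← Real.sqrt_sq hβ.le, ← Real.sqrt_mul (sq_nonneg β), Real.sqrt_sq hβ.le]
      have := Real.lt_sqrt_of_sq_lt
        (show (A0 n m β * β - 2) ^ 2 < β ^ 2 * ((A0 n m β) ^ 2 -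
          8 * ((n : ℝ) - 2 - n * m) * (1 - m)) by linarith)
      linarith
    · have hβpos : 0 < β := hβe.trans ((le_max_right _ _).trans_lt hβ0)
      have hkq : 2 * (1 - m) < (n : ℝ) - 2 - n * m := by
        rw [lt_div_iff₀ (by linarith)] at hmn
        linarith
      rw [beta1, le_div_iff₀ hk] at hβ
      have hAβ : A0 n m β * β < 2 := by
        rw [hAk]
        nlinarith
      exact div_pos (by linarith [mul_nonneg hβpos.le (Real.sqrt_nonneg
        ((A0 n m β) ^ 2 - 8 * ((n : ℝ) - 2 - n * m) * (1 - m)))]) hq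
  · rintro ⟨hβ0, hβ, h⟩
    have hβpos : 0 < β := hβe.trans ((le_max_right _ _).trans_lt hβ0)
    have hA := two_lt_A0_mul hm0 hm hβpos hk (lt_two_mul_one_sub hn hm0 h)
      ((le_max_left _ _).trans_lt hβ0)
    rw [beta1, lt_div_iff₀ hk] at hβ
    have hpos : 0 < (1 - ((n : ℝ) - 2 - n * m) * β) * (1 + 2 * m * β) :=
      mul_pos (by linarith) (by positivity)
    refine div_neg_of_neg_of_pos ?_ hq
    rw [← Real.sqrt_sq hβpos.le, ← Real.sqrt_mul (sq_nonneg β), Real.sqrt_sq hβpos.le]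
    have := (Real.sqrt_lt' (show 0 < A0 n m β * β - 2 by linarith)).2
      (show β ^ 2 * ((A0 n m β) ^ 2 -
          8 * ((n : ℝ) - 2 - n * m) * (1 - m)) < (A0 n m β * β - 2) ^ 2 by linarith)
    linarith
  · rintro ⟨hβ, h⟩
    have hβpos : 0 < β := hβ ▸ hβ1
    have hkq := lt_two_mul_one_sub hn hm0 h
    rw [beta1, eq_div_iff hk.ne'] at hβ
    have hkβ : ((n : ℝ) - 2 - n * m) * β = 1 := by linarith
    have hA : 2 < A0 n m β * β := by
      rw [hAk, hkβ]
      nlinarith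
    have hroot : β * √((A0 n m β) ^ 2 - 8 * ((n : ℝ) - 2 - n * m) * (1 - m)) =
        A0 n m β * β - 2 := by
      rw [hkβ] at hfac
      rw [← Real.sqrt_sq (show 0 ≤ A0 n m β * β - 2 by linarith),
        show (A0 n m β * β - 2) ^ 2 = β ^ 2 * ((A0 n m β) ^ 2 -
          8 * ((n : ℝ) - 2 - n * m) * (1 - m)) by linarith,
        Real.sqrt_mul (sq_nonneg β), Real.sqrt_sq hβpos.le]
    rw [hroot]
    exact ⟨by simp, div_neg_of_neg_of_pos (by linarith) hq⟩
end

section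
/- Let β > β_0(m) and let w be as in the context. Then there exists a constant C > 0 such that |w(s)| ≤ C e^{−γ_1 s} for all s ∈ ℝ. Moreover: (a) if A_1(m,β) > 0, then w(s) < 0 for all s ∈ ℝ; (b) if A_1(m,β) < 0, then there exists s_* ∈ ℝ such that w(s) > 0 for all s ≥ s_*; (c) if A_1(m,β) ≠ 0, then the integral I_1 = ∫_ℝ e^{γ_1 t} Φ(t) dt is finite and 0 < I_1 < ∞; (d) if A_1(m,β) = 0 and A_2(m,β) < 0, then w(s) < 0 for all s ∈ ℝ and the integral I_2 = ∫_ℝ e^{γ_2 t} Φ(t) dt is finite and 0 < I_2 < ∞. -/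
open Real Filter MeasureTheory Set Topology

theorem hasDerivAt_exp_mul_mul {z : ℝ → ℝ} {z' s : ℝ} (g : ℝ) (hz : HasDerivAt z z' s) :
    HasDerivAt (fun t => Real.exp (g * t) * z t) (Real.exp (g * s) * (z' + g * z s)) s := by
  have h : HasDerivAt (fun t : ℝ => Real.exp (g * t)) (Real.exp (g * s) * g) s := by
    simpa using ((hasDerivAt_id s).const_mul g).exp
  exact (h.mul hz).congr_deriv (by ring)

theorem le_of_hasDerivAt_nonpos {f f' : ℝ → ℝ} {S s : ℝ} (hf : ∀ t, HasDerivAt f (f' t) t)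
    (hf' : ∀ t, S ≤ t → f' t ≤ 0) (hs : S ≤ s) : f s ≤ f S := by
  have : AntitoneOn f (Set.Ici S) := by
    refine antitoneOn_of_hasDerivWithinAt_nonpos (convex_Ici S) (f' := f')
      (fun t _ => (hf t).continuousAt.continuousWithinAt)
      (fun t _ => (hf t).hasDerivWithinAt) fun t ht => hf' t ?_
    rw [interior_Ici] at ht
    exact le_of_lt ht
  exact this Set.self_mem_Ici hs hs

theorem tendsto_exp_mul_atTop_zero {g : ℝ} (hg : g < 0) :
    Tendsto (fun s : ℝ => Real.exp (g * s)) atTop (𝓝 0) :=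
  Real.tendsto_exp_atBot.comp (tendsto_id.const_mul_atTop_of_neg hg)

/-- A solution of `z' ≤ -g z + h` with `g > 0` and `h → 0` is eventually below any `ε > 0`. -/
theorem eventually_lt_of_hasDerivAt_linear {z z' h : ℝ → ℝ} {g : ℝ} (hg : 0 < g)
    (hz : ∀ s, HasDerivAt z (z' s) s) (hle : ∀ s, z' s ≤ -g * z s + h s)
    (hh : Tendsto h atTop (𝓝 0)) {ε : ℝ} (hε : 0 < ε) : ∀ᶠ s in atTop, z s < ε := by
  obtain ⟨S, hS⟩ := eventually_atTop.1 (hh.eventually_lt_const (show 0 < g * (ε / 2) by positivity))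
  set D := Real.exp (g * S) * (z S - ε / 2) with hD
  have hlim : Tendsto (fun s : ℝ => Real.exp (-g * s) * D) atTop (𝓝 0) := by
    simpa using (tendsto_exp_mul_atTop_zero (neg_lt_zero.2 hg)).mul_const D
  filter_upwards [eventually_ge_atTop S, hlim.eventually_lt_const (half_pos hε)] with s hs h2
  have h1 := le_of_hasDerivAt_nonpos
    (fun t => hasDerivAt_exp_mul_mul g ((hz t).sub_const (ε / 2)))
    (fun t ht => mul_nonpos_of_nonneg_of_nonpos (Real.exp_pos _).le
      (by linarith [hS t ht, hle t])) hs
  have h3 := mul_le_mul_of_nonneg_left h1 (Real.exp_pos (-g * s)).le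
  rw [← mul_assoc, ← Real.exp_add, show -g * s + g * s = 0 by ring, Real.exp_zero, ← hD] at h3
  linarith

theorem tendsto_zero_of_hasDerivAt_linear {z h : ℝ → ℝ} {g : ℝ} (hg : 0 < g)
    (hz : ∀ s, HasDerivAt z (-g * z s + h s) s) (hh : Tendsto h atTop (𝓝 0)) :
    Tendsto z atTop (𝓝 0) := by
  rw [Metric.tendsto_nhds]
  intro ε hε
  have h1 := eventually_lt_of_hasDerivAt_linear hg hz (fun _ => le_rfl) hh hε
  have h2 := eventually_lt_of_hasDerivAt_linear hg (z := fun s => -z s)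
    (h := fun s => -h s) (fun s => (hz s).fun_neg) (fun s => by linarith) (by simpa using hh.neg) hε
  filter_upwards [h1, h2] with s h1 h2
  rw [Real.dist_eq, sub_zero, abs_lt]
  constructor <;> linarith

/-- A nonnegative function tending to zero and satisfying `N' ≤ -2gN + C N^(3/2)` decays at the
linear rate `exp (-2gs)`. -/
theorem exists_le_exp_of_hasDerivAt_le {N N' : ℝ → ℝ} {g C S₀ : ℝ} (hg : 0 < g) (hC : 0 ≤ C)
    (hN : ∀ s, HasDerivAt N (N' s) s) (hN0 : ∀ s, 0 ≤ N s)
    (hle : ∀ s, S₀ ≤ s → N' s ≤ -2 * g * N s + C * (N s * √(N s)))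
    (hlim : Tendsto N atTop (𝓝 0)) :
    ∃ S D : ℝ, 0 ≤ D ∧ ∀ s, S ≤ s → N s ≤ D * Real.exp (-2 * g * s) := by
  have hlim' : Tendsto (fun s => C * √(N s)) atTop (𝓝 0) := by
    simpa using (hlim.sqrt).const_mul C
  obtain ⟨S₁, hS₁⟩ := eventually_atTop.1 (hlim'.eventually_lt_const (half_pos hg))
  set S := max S₀ S₁
  set D₁ := Real.exp (3 / 2 * g * S) * N S
  have hD₁ : 0 ≤ D₁ := mul_nonneg (Real.exp_pos _).le (hN0 S)
  have hfirst : ∀ s, S ≤ s → N s ≤ D₁ * Real.exp (-(3 / 2 * g) * s) := by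
    intro s hs
    have h1 := le_of_hasDerivAt_nonpos
      (fun t => hasDerivAt_exp_mul_mul (3 / 2 * g) (hN t))
      (fun t ht => mul_nonpos_of_nonneg_of_nonpos (Real.exp_pos _).le (by
        have h2 := hle t ((le_max_left _ _).trans ht)
        have h3 := mul_le_mul_of_nonneg_left (hS₁ t ((le_max_right _ _).trans ht)).le (hN0 t)
        nlinarith)) hs
    have h3 := mul_le_mul_of_nonneg_left h1 (Real.exp_pos (-(3 / 2 * g) * s)).le
    rw [← mul_assoc, ← Real.exp_add, show -(3 / 2 * g) * s + 3 / 2 * g * s = 0 by ring,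
      Real.exp_zero] at h3
    linarith
  set E := C * (D₁ * √D₁)
  have hE : 0 ≤ E := by positivity
  have hbound : ∀ s, S ≤ s →
      Real.exp (2 * g * s) * (C * (N s * √(N s))) ≤ E * Real.exp (-(g / 4) * s) := by
    intro s hs
    have h1 := hfirst s hs
    have h2 : √(N s) ≤ √D₁ * Real.exp (-(3 / 4 * g) * s) := by
      rw [Real.sqrt_le_left (by positivity), mul_pow, Real.sq_sqrt hD₁, ← Real.exp_nat_mul]
      convert h1 using 3
      push_cast
      ring
    calc Real.exp (2 * g * s) * (C * (N s * √(N s)))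
        ≤ Real.exp (2 * g * s) * (C * ((D₁ * Real.exp (-(3 / 2 * g) * s)) *
            (√D₁ * Real.exp (-(3 / 4 * g) * s)))) := by
          have := hN0 s
          gcongr
      _ = E * (Real.exp (2 * g * s) * Real.exp (-(3 / 2 * g) * s) *
            Real.exp (-(3 / 4 * g) * s)) := by ring
      _ = E * Real.exp (-(g / 4) * s) := by
          rw [← Real.exp_add, ← Real.exp_add]
          congr 2
          ring
  have hderiv : ∀ t, HasDerivAt
      (fun t => Real.exp (2 * g * t) * N t + 4 * E / g * (Real.exp (-(g / 4) * t) * 1))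
      (Real.exp (2 * g * t) * (N' t + 2 * g * N t) +
        4 * E / g * (Real.exp (-(g / 4) * t) * (0 + -(g / 4) * 1))) t := fun t =>
    (hasDerivAt_exp_mul_mul (2 * g) (hN t)).add
      ((hasDerivAt_exp_mul_mul (-(g / 4)) (hasDerivAt_const t (1 : ℝ))).const_mul _)
  refine ⟨S, Real.exp (2 * g * S) * N S + 4 * E / g * (Real.exp (-(g / 4) * S) * 1),
    add_nonneg (mul_nonneg (Real.exp_pos _).le (hN0 S)) (by positivity), fun s hs => ?_⟩
  have h1 := le_of_hasDerivAt_nonpos hderiv (fun t ht => by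
    have h2 := mul_le_mul_of_nonneg_left (hle t ((le_max_left _ _).trans ht))
      (Real.exp_pos (2 * g * t)).le
    have h3 := hbound t ht
    have h4 : 4 * E / g * (Real.exp (-(g / 4) * t) * (0 + -(g / 4) * 1)) =
        -(E * Real.exp (-(g / 4) * t)) := by
      field_simp
      ring
    rw [h4]
    linarith) hs
  have h5 : 0 ≤ 4 * E / g * (Real.exp (-(g / 4) * s) * 1) := by positivity
  have h6 := mul_le_mul_of_nonneg_left ((le_add_of_nonneg_right h5).trans h1)
    (Real.exp_pos (-2 * g * s)).le
  rw [← mul_assoc, ← Real.exp_add, show -2 * g * s + 2 * g * s = 0 by ring, Real.exp_zero] at h6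
  linarith

theorem exists_seq_tendsto_exp_mul_deriv {w v F : ℝ → ℝ} {g a b : ℝ} (hg : 0 < g)
    (hw : ∀ s, HasDerivAt w (v s) s) (hwa : Tendsto w atBot (𝓝 a)) (hF : Tendsto F atBot (𝓝 b)) :
    ∃ t : ℕ → ℝ, Tendsto t atTop atBot ∧
      Tendsto (fun k => Real.exp (g * t k) * (v (t k) + F (t k))) atTop (𝓝 0) := by
  have hex : ∀ k : ℕ, ∃ t ∈ Set.Ioo (-(k : ℝ) - 1) (-(k : ℝ)), v t = w (-k) - w (-k - 1) := by
    intro k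
    obtain ⟨t, ht, h⟩ := exists_hasDerivAt_eq_slope w v (show -(k : ℝ) - 1 < -k by linarith)
      (fun x _ => (hw x).continuousAt.continuousWithinAt) (fun x _ => hw x)
    exact ⟨t, ht, by rw [h]; ring⟩
  choose t ht hvt using hex
  have hk : Tendsto (fun k : ℕ => -(k : ℝ)) atTop atBot :=
    tendsto_neg_atTop_atBot.comp tendsto_natCast_atTop_atTop
  have hk1 : Tendsto (fun k : ℕ => -(k : ℝ) - 1) atTop atBot :=
    tendsto_atBot_add_const_right _ _ hk
  have htlim : Tendsto t atTop atBot := tendsto_atBot_mono (fun k => (ht k).2.le) hk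
  refine ⟨t, htlim, ?_⟩
  have hv : Tendsto (fun k => v (t k)) atTop (𝓝 (a - a)) := by
    simp_rw [hvt]
    exact (hwa.comp hk).sub (hwa.comp hk1)
  have he : Tendsto (fun k => Real.exp (g * t k)) atTop (𝓝 0) :=
    Real.tendsto_exp_atBot.comp (htlim.const_mul_atBot hg)
  simpa using he.mul (hv.add (hF.comp htlim))

theorem neg_of_deriv_add_mul_nonpos {w v : ℝ → ℝ} {g a : ℝ} (hw : ∀ s, HasDerivAt w (v s) s)
    (hwa : Tendsto w atBot (𝓝 a)) (ha : a < 0) (h : ∀ s, v s + g * w s ≤ 0) (s : ℝ) : w s < 0 := by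
  obtain ⟨t, ht, hts⟩ := ((hwa.eventually_lt_const ha).and (eventually_le_atBot s)).exists
  have h1 := antitone_of_hasDerivAt_nonpos (fun t => hasDerivAt_exp_mul_mul g (hw t))
    (fun t => mul_nonpos_of_nonneg_of_nonpos (Real.exp_pos _).le (h t)) hts
  exact neg_of_mul_neg_right (h1.trans_lt (mul_neg_of_pos_of_neg (Real.exp_pos _) ht))
    (Real.exp_pos (g * s)).le

theorem integrable_exp_mul_and_integral_pos {Φ : ℝ → ℝ} {g B D S s₀ : ℝ} (hg : 0 < g)
    (hc : Continuous Φ) (h0 : ∀ s, 0 ≤ Φ s) (hB : ∀ s, Φ s ≤ B)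
    (hD : ∀ s, S ≤ s → Φ s ≤ D * Real.exp (-2 * g * s)) (hs₀ : Φ s₀ ≠ 0) :
    Integrable (fun t : ℝ => Real.exp (g * t) * Φ t) ∧ 0 < ∫ t : ℝ, Real.exp (g * t) * Φ t := by
  have hcont : Continuous fun t : ℝ => Real.exp (g * t) * Φ t := by fun_prop
  have hnn : ∀ t : ℝ, 0 ≤ Real.exp (g * t) * Φ t := fun t =>
    mul_nonneg (Real.exp_pos _).le (h0 t)
  have hint : Integrable (fun t : ℝ => Real.exp (g * t) * Φ t) := by
    rw [← integrableOn_univ, ← Set.Iic_union_Ioi (a := S)]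
    refine IntegrableOn.union ?_ ?_
    · refine Integrable.mono' ((integrableOn_exp_mul_Iic hg S).mul_const B)
        hcont.aestronglyMeasurable (ae_of_all _ fun t => ?_)
      rw [Real.norm_of_nonneg (hnn t)]
      exact mul_le_mul_of_nonneg_left (hB t) (Real.exp_pos _).le
    · refine Integrable.mono' ((integrableOn_exp_mul_Ioi (neg_lt_zero.2 hg) S).const_mul D)
        hcont.aestronglyMeasurable (ae_restrict_of_forall_mem measurableSet_Ioi fun t ht => ?_)
      rw [Real.norm_of_nonneg (hnn t)]
      refine (mul_le_mul_of_nonneg_left (hD t (le_of_lt ht)) (Real.exp_pos _).le).trans_eq ?_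
      rw [mul_left_comm, ← Real.exp_add]
      congr 2
      ring
  exact ⟨hint, integral_pos_of_integrable_nonneg_nonzero hcont hint hnn
    (mul_ne_zero (Real.exp_pos _).ne' hs₀)⟩

theorem eventually_pos_of_le_deriv_add_mul {w v : ℝ → ℝ} {g₁ g₂ c K S₀ : ℝ} (hg₁ : 0 < g₁)
    (hg : g₁ < g₂) (hc : 0 < c) (hw : ∀ s, HasDerivAt w (v s) s)
    (h : ∀ s, S₀ ≤ s →
      c * Real.exp (-g₁ * s) - K * Real.exp (-2 * g₁ * s) ≤ v s + g₂ * w s) :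
    ∀ᶠ s in atTop, 0 < w s := by
  have hlim : Tendsto (fun s : ℝ => Real.exp (-g₁ * s) * K) atTop (𝓝 0) := by
    simpa using (tendsto_exp_mul_atTop_zero (neg_lt_zero.2 hg₁)).mul_const K
  obtain ⟨S₁, hS₁⟩ := eventually_atTop.1 (hlim.eventually_lt_const (half_pos hc))
  set S := max S₀ S₁
  set q := c / 2 / (g₂ - g₁) with hq
  have hd : 0 < g₂ - g₁ := sub_pos.2 hg
  have hqpos : 0 < q := by positivity
  have hderiv : ∀ t, HasDerivAt
      (fun t => q * (Real.exp ((g₂ - g₁) * t) * 1) - Real.exp (g₂ * t) * w t)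
      (q * (Real.exp ((g₂ - g₁) * t) * (0 + (g₂ - g₁) * 1)) -
        Real.exp (g₂ * t) * (v t + g₂ * w t)) t := fun t =>
    ((hasDerivAt_exp_mul_mul _ (hasDerivAt_const t (1 : ℝ))).const_mul _).sub
      (hasDerivAt_exp_mul_mul g₂ (hw t))
  have htop : Tendsto (fun t : ℝ => q * (Real.exp ((g₂ - g₁) * t) * 1)) atTop atTop := by
    simp_rw [mul_one]
    exact (Real.tendsto_exp_atTop.comp (tendsto_id.const_mul_atTop hd)).const_mul_atTop hqpos
  filter_upwards [eventually_ge_atTop S, htop.eventually_gt_atTop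
    (q * (Real.exp ((g₂ - g₁) * S) * 1) - Real.exp (g₂ * S) * w S)] with s hs hgt
  have h1 := le_of_hasDerivAt_nonpos hderiv (fun t ht => by
    have h2 := h t ((le_max_left _ _).trans ht)
    have h3 := hS₁ t ((le_max_right _ _).trans ht)
    have e1 : Real.exp (-2 * g₁ * t) = Real.exp (-g₁ * t) * Real.exp (-g₁ * t) := by
      rw [← Real.exp_add]
      congr 1
      ring
    have e2 : Real.exp ((g₂ - g₁) * t) = Real.exp (g₂ * t) * Real.exp (-g₁ * t) := by
      rw [← Real.exp_add]
      congr 1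
      ring
    have e3 : q * (Real.exp ((g₂ - g₁) * t) * (0 + (g₂ - g₁) * 1)) =
        Real.exp (g₂ * t) * (c / 2 * Real.exp (-g₁ * t)) := by
      rw [e2, hq]
      field_simp
      ring
    rw [e3, sub_nonpos]
    refine mul_le_mul_of_nonneg_left (le_trans ?_ h2) (Real.exp_pos _).le
    rw [e1]
    nlinarith [mul_lt_mul_of_pos_right h3 (Real.exp_pos (-g₁ * t))]) hs
  exact pos_of_mul_pos_right (by linarith) (Real.exp_pos (g₂ * s)).le

theorem exists_abs_le_of_tendsto {w : ℝ → ℝ} {a b : ℝ} (hc : Continuous w)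
    (ha : Tendsto w atBot (𝓝 a)) (hb : Tendsto w atTop (𝓝 b)) : ∃ M, ∀ s, |w s| ≤ M := by
  obtain ⟨S, hS⟩ := eventually_atBot.1 (ha.abs.eventually_lt_const (lt_add_one |a|))
  obtain ⟨T, hT⟩ := eventually_atTop.1 (hb.abs.eventually_lt_const (lt_add_one |b|))
  obtain ⟨M, hM⟩ := (isCompact_Icc (a := S) (b := T)).exists_bound_of_continuousOn hc.continuousOn
  refine ⟨max M (max (|a| + 1) (|b| + 1)), fun s => ?_⟩
  rcases le_total s S with h | h
  · exact le_max_of_le_right (le_max_of_le_left (hS s h).le)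
  rcases le_total T s with h' | h'
  · exact le_max_of_le_right (le_max_of_le_right (hT s h').le)
  · exact le_max_of_le_left (hM s ⟨h, h'⟩)

/-- Convexity and differentiability give a quadratic bound for `(1 + x)^p - 1 - p x` near `0`. -/
theorem exists_rpow_one_add_sub_le_mul_sq {p : ℝ} (hp : 1 ≤ p) :
    ∃ K : ℝ, 0 < K ∧ ∀ᶠ x in 𝓝 (0 : ℝ), (1 + x) ^ p - 1 - p * x ≤ K * x ^ 2 := by
  have hd : HasDerivAt (fun x : ℝ => (1 + x) ^ (p - 1))
      (1 * (p - 1) * (1 + 0) ^ (p - 1 - 1)) 0 :=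
    ((hasDerivAt_id (0 : ℝ)).const_add 1).rpow_const (by simp)
  obtain ⟨C, hC, hO⟩ := hd.isBigO_sub.exists_pos
  refine ⟨p * C, by positivity, ?_⟩
  filter_upwards [hO.bound, lt_mem_nhds (show (-1 : ℝ) < 0 by norm_num)] with x hx hx1
  have h1 : 0 < 1 + x := by linarith
  have hs : 1 + -x / (1 + x) = (1 + x)⁻¹ := by
    field_simp
    ring
  have hB := one_add_mul_self_le_rpow_one_add (s := -x / (1 + x))
    (by have := inv_pos.2 h1; linarith) hp
  rw [hs, Real.inv_rpow h1.le] at hB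
  have hpos : 0 < (1 + x) ^ p := Real.rpow_pos_of_pos h1 p
  have h2 := mul_le_mul_of_nonneg_left hB hpos.le
  rw [mul_inv_cancel₀ hpos.ne'] at h2
  have h3 : (1 + x) ^ p = (1 + x) ^ (p - 1) * (1 + x) := by
    rw [Real.rpow_sub_one h1.ne']
    field_simp
  have h4 : (1 + x) ^ p * (1 + p * (-x / (1 + x))) = (1 + x) ^ p - p * x * (1 + x) ^ (p - 1) := by
    rw [h3]
    field_simp
    ring
  rw [h4] at h2
  simp only [add_zero, Real.one_rpow, sub_zero, Real.norm_eq_abs] at hx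
  have h5 : ((1 + x) ^ (p - 1) - 1) * x ≤ C * x ^ 2 := by
    calc _ ≤ |((1 + x) ^ (p - 1) - 1) * x| := le_abs_self _
      _ = |(1 + x) ^ (p - 1) - 1| * |x| := abs_mul _ _
      _ ≤ C * |x| * |x| := by gcongr
      _ = C * x ^ 2 := by rw [mul_assoc, abs_mul_abs_self, sq]
  nlinarith [mul_le_mul_of_nonneg_left h5 (show 0 ≤ p by linarith)]

/-- Quadratic decay for a diagonalised two-dimensional system with a quadratic perturbation. -/
theorem exists_sq_le_exp_of_system {z₁ z₂ w Φ : ℝ → ℝ} {g₁ g₂ a₁ a₂ K : ℝ}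
    (hg₁ : 0 < g₁) (hg : g₁ < g₂)
    (hz₁ : ∀ s, HasDerivAt z₁ (-g₁ * z₁ s + -a₁ * Φ s) s)
    (hz₂ : ∀ s, HasDerivAt z₂ (-g₂ * z₂ s + -a₂ * Φ s) s)
    (hzw : ∀ s, z₁ s - z₂ s = (g₂ - g₁) * w s) (hΦ0 : ∀ s, 0 ≤ Φ s) (hK0 : 0 ≤ K)
    (hK : ∀ᶠ s in atTop, Φ s ≤ K * w s ^ 2) (htop : Tendsto w atTop (𝓝 0)) :
    ∃ S D : ℝ, 0 ≤ D ∧ ∀ s, S ≤ s → w s ^ 2 ≤ D * Real.exp (-2 * g₁ * s) := by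
  have hd : 0 < g₂ - g₁ := sub_pos.2 hg
  have hΦtop : Tendsto Φ atTop (𝓝 0) :=
    squeeze_zero' (Eventually.of_forall hΦ0) hK (by simpa using (htop.pow 2).const_mul K)
  have hl₁ := tendsto_zero_of_hasDerivAt_linear hg₁ hz₁ (by simpa using hΦtop.const_mul (-a₁))
  have hl₂ := tendsto_zero_of_hasDerivAt_linear (hg₁.trans hg) hz₂
    (by simpa using hΦtop.const_mul (-a₂))
  obtain ⟨S₀, hS₀⟩ := eventually_atTop.1 hK
  have hwN : ∀ s, w s ^ 2 ≤ 2 / (g₂ - g₁) ^ 2 * (z₁ s ^ 2 + z₂ s ^ 2) := by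
    intro s
    have h1 : (g₂ - g₁) ^ 2 * w s ^ 2 ≤ 2 * (z₁ s ^ 2 + z₂ s ^ 2) := by
      rw [← mul_pow, ← hzw]
      nlinarith [sq_nonneg (z₁ s + z₂ s)]
    rw [div_mul_eq_mul_div, le_div_iff₀ (by positivity)]
    linarith
  have hN : ∀ s, HasDerivAt (fun t => z₁ t ^ 2 + z₂ t ^ 2)
      (2 * z₁ s * (-g₁ * z₁ s + -a₁ * Φ s) + 2 * z₂ s * (-g₂ * z₂ s + -a₂ * Φ s)) s := fun s =>
    (((hz₁ s).fun_pow 2).add ((hz₂ s).fun_pow 2)).congr_deriv (by push_cast; ring)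
  obtain ⟨S, D, hD, h⟩ := exists_le_exp_of_hasDerivAt_le
    (C := 2 * (|a₁| + |a₂|) * (K * (2 / (g₂ - g₁) ^ 2))) (S₀ := S₀) hg₁ (by positivity) hN
    (fun s => by positivity) (fun s hs => by
      set N := z₁ s ^ 2 + z₂ s ^ 2 with hNdef
      have hr₁ : |z₁ s| ≤ √N := Real.abs_le_sqrt (by rw [hNdef]; linarith [sq_nonneg (z₂ s)])
      have hr₂ : |z₂ s| ≤ √N := Real.abs_le_sqrt (by rw [hNdef]; linarith [sq_nonneg (z₁ s)])
      have hΦN : Φ s ≤ K * (2 / (g₂ - g₁) ^ 2) * N := by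
        have := mul_le_mul_of_nonneg_left (hwN s) hK0
        linarith [hS₀ s hs]
      have hp₁ : -(a₁ * z₁ s) ≤ |a₁| * √N := by
        refine (neg_le_abs _).trans ?_
        rw [abs_mul]
        gcongr
      have hp₂ : -(a₂ * z₂ s) ≤ |a₂| * √N := by
        refine (neg_le_abs _).trans ?_
        rw [abs_mul]
        gcongr
      have hq₁ := mul_le_mul_of_nonneg_right (add_le_add hp₁ hp₂) (hΦ0 s)
      have hq₂ := mul_le_mul_of_nonneg_left hΦN
        (show 0 ≤ |a₁| * √N + |a₂| * √N by positivity)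
      have hq₃ : 0 ≤ (g₂ - g₁) * z₂ s ^ 2 := by positivity
      nlinarith) (by simpa using (hl₁.pow 2).add (hl₂.pow 2))
  refine ⟨S, 2 / (g₂ - g₁) ^ 2 * D, by positivity, fun s hs => (hwN s).trans ?_⟩
  rw [mul_assoc]
  exact mul_le_mul_of_nonneg_left (h s hs) (by positivity)

theorem exists_sq_le_exp_of_deriv_eq {w v Φ : ℝ → ℝ} {g κ K : ℝ} (hg : 0 < g) (hκ : 0 ≤ κ)
    (hw : ∀ s, HasDerivAt w (v s) s) (hv : ∀ s, v s + (g * w s + κ * Φ s) = 0)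
    (hΦ0 : ∀ s, 0 ≤ Φ s) (hK0 : 0 ≤ K) (hK : ∀ᶠ s in atTop, Φ s ≤ K * w s ^ 2)
    (htop : Tendsto w atTop (𝓝 0)) :
    ∃ S D : ℝ, 0 ≤ D ∧ ∀ s, S ≤ s → w s ^ 2 ≤ D * Real.exp (-2 * g * s) := by
  obtain ⟨S₀, hS₀⟩ := eventually_atTop.1 hK
  refine exists_le_exp_of_hasDerivAt_le (C := 2 * κ * K) (S₀ := S₀)
    (N' := fun s => 2 * w s * v s) hg (by positivity)
    (fun s => ((hw s).fun_pow 2).congr_deriv (by push_cast; ring))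
    (fun s => by positivity) (fun s hs => ?_) (by simpa using htop.pow 2)
  rw [Real.sqrt_sq_eq_abs, show v s = -(g * w s + κ * Φ s) by linarith [hv s]]
  have h1 : -w s * Φ s ≤ |w s| * (K * w s ^ 2) :=
    mul_le_mul (neg_le_abs _) (hS₀ s hs) (hΦ0 s) (abs_nonneg _)
  nlinarith [mul_le_mul_of_nonneg_left h1 hκ]

theorem nonpos_of_hasDerivAt_of_tendsto_atBot {w v F Φ : ℝ → ℝ} {g a b c : ℝ} (hg : 0 < g)
    (ha : 0 ≤ a) (hw : ∀ s, HasDerivAt w (v s) s)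
    (hz : ∀ s, HasDerivAt (fun t => v t + F t) (-g * (v s + F s) + -a * Φ s) s)
    (hΦ0 : ∀ s, 0 ≤ Φ s) (hwb : Tendsto w atBot (𝓝 b)) (hF : Tendsto F atBot (𝓝 c)) (s : ℝ) :
    v s + F s ≤ 0 := by
  obtain ⟨t, ht, hlim⟩ := exists_seq_tendsto_exp_mul_deriv hg hw hwb hF
  have hanti := antitone_of_hasDerivAt_nonpos (fun t => hasDerivAt_exp_mul_mul g (hz t))
    (fun t => mul_nonpos_of_nonneg_of_nonpos (Real.exp_pos _).le (by
      linarith [mul_nonneg ha (hΦ0 t)]))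
  have h := ge_of_tendsto hlim ((ht.eventually (eventually_le_atBot s)).mono fun k hk => hanti hk)
  exact nonpos_of_mul_nonpos_right h (Real.exp_pos _)

/-- The transformed system: `z_j = w' + g_{3-j} w + κ Φ` satisfies `z_j' = -g_j z_j - a_j Φ`. -/
theorem decay_and_sign_of_system {w v Φ : ℝ → ℝ} {g₁ g₂ κ a₁ a₂ K b : ℝ}
    (hg₁ : 0 < g₁) (hg : g₁ < g₂) (hκ : 0 ≤ κ) (hw : ∀ s, HasDerivAt w (v s) s)
    (hz₁ : ∀ s, HasDerivAt (fun t => v t + (g₂ * w t + κ * Φ t))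
      (-g₁ * (v s + (g₂ * w s + κ * Φ s)) + -a₁ * Φ s) s)
    (hz₂ : ∀ s, HasDerivAt (fun t => v t + (g₁ * w t + κ * Φ t))
      (-g₂ * (v s + (g₁ * w s + κ * Φ s)) + -a₂ * Φ s) s)
    (hΦc : Continuous Φ) (hΦ0 : ∀ s, 0 ≤ Φ s) (hΦpos : ∀ s, w s ≠ 0 → 0 < Φ s)
    (hK0 : 0 ≤ K) (hK : ∀ᶠ s in atTop, Φ s ≤ K * w s ^ 2)
    (hbot : Tendsto w atBot (𝓝 (-1))) (hΦbot : Tendsto Φ atBot (𝓝 b))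
    (htop : Tendsto w atTop (𝓝 0)) :
    (∃ C : ℝ, 0 < C ∧ ∀ s : ℝ, |w s| ≤ C * Real.exp (-g₁ * s)) ∧
    (0 ≤ a₁ → ∀ s : ℝ, w s < 0) ∧
    (a₁ < 0 → ∃ sStar : ℝ, ∀ s, sStar ≤ s → 0 < w s) ∧
    (Integrable (fun t : ℝ => Real.exp (g₁ * t) * Φ t) ∧
      0 < ∫ t : ℝ, Real.exp (g₁ * t) * Φ t) ∧
    (a₁ = 0 → Integrable (fun t : ℝ => Real.exp (g₂ * t) * Φ t) ∧
      0 < ∫ t : ℝ, Real.exp (g₂ * t) * Φ t) := by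
  have hwc : Continuous w := continuous_iff_continuousAt.2 fun s => (hw s).continuousAt
  have hΦtop : Tendsto Φ atTop (𝓝 0) :=
    squeeze_zero' (Eventually.of_forall hΦ0) hK (by simpa using (htop.pow 2).const_mul K)
  obtain ⟨M, hM⟩ := exists_abs_le_of_tendsto hwc hbot htop
  obtain ⟨B, hB⟩ := exists_abs_le_of_tendsto hΦc hΦbot hΦtop
  obtain ⟨S₀, hS₀⟩ := eventually_atTop.1 hK
  obtain ⟨T, hT⟩ := eventually_atBot.1 (hbot.eventually_lt_const (show (-1 : ℝ) < 0 by norm_num))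
  have hF : Tendsto (fun t => g₂ * w t + κ * Φ t) atBot (𝓝 (g₂ * -1 + κ * b)) :=
    (hbot.const_mul g₂).add (hΦbot.const_mul κ)
  have hz_nonpos : 0 ≤ a₁ → ∀ s, v s + (g₂ * w s + κ * Φ s) ≤ 0 := fun ha =>
    nonpos_of_hasDerivAt_of_tendsto_atBot hg₁ ha hw hz₁ hΦ0 hbot hF
  have hz_nonneg : a₁ ≤ 0 → ∀ s, 0 ≤ v s + (g₂ * w s + κ * Φ s) := fun ha s => by
    have := nonpos_of_hasDerivAt_of_tendsto_atBot (w := fun t => -w t) (v := fun t => -v t)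
      (F := fun t => -(g₂ * w t + κ * Φ t)) hg₁ (neg_nonneg.2 ha) (fun s => (hw s).fun_neg)
      (fun s => by
        have h := (hz₁ s).fun_neg
        simp only [neg_add] at h ⊢
        exact h.congr_deriv (by ring)) hΦ0 hbot.neg hF.neg s
    linarith
  have hint : ∀ {g S D : ℝ}, 0 < g → (∀ s, S ≤ s → w s ^ 2 ≤ D * Real.exp (-2 * g * s)) →
      Integrable (fun t : ℝ => Real.exp (g * t) * Φ t) ∧
        0 < ∫ t : ℝ, Real.exp (g * t) * Φ t := fun {g S D} hg h =>
    integrable_exp_mul_and_integral_pos (S := max S₀ S) (D := K * D) (s₀ := T) hg hΦc hΦ0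
      (fun s => (le_abs_self _).trans (hB s)) (fun s hs => by
        rw [mul_assoc]
        exact (hS₀ s ((le_max_left _ _).trans hs)).trans
          (mul_le_mul_of_nonneg_left (h s ((le_max_right _ _).trans hs)) hK0))
      (hΦpos T (hT T le_rfl).ne).ne'
  obtain ⟨S, D, hD0, hD⟩ := exists_sq_le_exp_of_system hg₁ hg hz₁ hz₂ (fun s => by ring) hΦ0
    hK0 hK htop
  refine ⟨⟨√D + M * Real.exp (g₁ * S) + 1, ?_, fun s => ?_⟩, fun ha => ?_, fun ha => ?_,
    hint hg₁ hD, fun ha => ?_⟩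
  · have hM0 : 0 ≤ M := (abs_nonneg _).trans (hM 0)
    positivity
  · have hM0 : 0 ≤ M := (abs_nonneg _).trans (hM 0)
    rcases le_total S s with hs | hs
    · have h1 : |w s| ≤ √D * Real.exp (-g₁ * s) := by
        refine abs_le_of_sq_le_sq ?_ (by positivity)
        rw [mul_pow, Real.sq_sqrt hD0, ← Real.exp_nat_mul]
        refine (hD s hs).trans_eq ?_
        congr 2
        push_cast
        ring
      refine h1.trans (mul_le_mul_of_nonneg_right ?_ (Real.exp_pos _).le)
      have : 0 ≤ M * Real.exp (g₁ * S) := by positivity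
      linarith
    · have h1 : 1 ≤ Real.exp (g₁ * S) * Real.exp (-g₁ * s) := by
        rw [← Real.exp_add, Real.one_le_exp_iff]
        nlinarith
      have h2 := mul_le_mul_of_nonneg_left h1 hM0
      have h3 : 0 ≤ (√D + 1) * Real.exp (-g₁ * s) := by positivity
      linarith [hM s]
  · exact neg_of_deriv_add_mul_nonpos (g := g₂) hw hbot (by norm_num) fun s => by
      linarith [hz_nonpos ha s, mul_nonneg hκ (hΦ0 s)]
  · have hX : ∀ s, HasDerivAt
        (fun t => Real.exp (g₁ * t) * (v t + (g₂ * w t + κ * Φ t)))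
        (Real.exp (g₁ * s) * (-a₁ * Φ s)) s := fun s =>
      (hasDerivAt_exp_mul_mul g₁ (hz₁ s)).congr_deriv (by ring)
    have hmono := monotone_of_hasDerivAt_nonneg hX fun s =>
      mul_nonneg (Real.exp_pos _).le (mul_nonneg (neg_nonneg.2 ha.le) (hΦ0 s))
    obtain ⟨s₁, hs₁⟩ : ∃ s, 0 < Real.exp (g₁ * s) * (v s + (g₂ * w s + κ * Φ s)) := by
      by_contra! hcon
      have hzero : (fun t => Real.exp (g₁ * t) * (v t + (g₂ * w t + κ * Φ t))) = fun _ => 0 :=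
        funext fun t => le_antisymm (hcon t)
          (mul_nonneg (Real.exp_pos _).le (hz_nonneg ha.le t))
      have h1 := hX T
      rw [hzero] at h1
      have h2 := h1.unique (hasDerivAt_const T (0 : ℝ))
      have h3 : 0 < Real.exp (g₁ * T) * (-a₁ * Φ T) :=
        mul_pos (Real.exp_pos _) (mul_pos (neg_pos.2 ha) (hΦpos T (hT T le_rfl).ne))
      exact h3.ne' h2
    refine eventually_atTop.1 (eventually_pos_of_le_deriv_add_mul (K := κ * (K * D))
      (S₀ := max s₁ (max S₀ S)) hg₁ hg hs₁ hw fun s hs => ?_)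
    have h1 := mul_le_mul_of_nonneg_right (hmono ((le_max_left _ _).trans hs))
      (Real.exp_pos (-g₁ * s)).le
    have h2 : Real.exp (g₁ * s) * (v s + (g₂ * w s + κ * Φ s)) * Real.exp (-g₁ * s) =
        v s + (g₂ * w s + κ * Φ s) := by
      rw [mul_right_comm, ← Real.exp_add, show g₁ * s + -g₁ * s = 0 by ring, Real.exp_zero, one_mul]
    have h3 := (le_max_right _ _).trans hs
    have h4 := mul_le_mul_of_nonneg_left ((hS₀ s ((le_max_left _ _).trans h3)).trans
      (mul_le_mul_of_nonneg_left (hD s ((le_max_right _ _).trans h3)) hK0)) hκ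
    simp only at h1
    rw [h2] at h1
    linarith
  · obtain ⟨S', D', -, hD'⟩ := exists_sq_le_exp_of_deriv_eq (hg₁.trans hg) hκ hw
      (fun s => le_antisymm (hz_nonpos ha.ge s) (hz_nonneg ha.le s)) hΦ0 hK0 hK htop
    exact hint (hg₁.trans hg) hD'

theorem gamma_roots {n : ℕ} {m β : ℝ} (hL : 0 < (n : ℝ) - 2 - n * m) (hk : 0 < 1 - m)
    (hβ : beta2 n m < β) :
    0 < gamma1 n m β ∧ gamma1 n m β < gamma2 n m β ∧
      gamma1 n m β + gamma2 n m β = A0 n m β / (1 - m) ∧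
      gamma1 n m β * gamma2 n m β = 2 * ((n : ℝ) - 2 - n * m) / (1 - m) := by
  unfold gamma1 gamma2
  set L := (n : ℝ) - 2 - n * m with hLdef
  set A := A0 n m β with hA
  have hr : 2 * L * √(2 * (1 - m) / L) < A := by
    have h1 := mul_lt_mul_of_pos_left hβ (show 0 < 2 * L by positivity)
    rw [beta2, ← hLdef, mul_add, mul_div_cancel₀ _ (by positivity)] at h1
    rw [hA, A0, ← hLdef]
    linarith
  have hr0 : 0 ≤ 2 * L * √(2 * (1 - m) / L) := by positivity
  have hAp : 0 < A := hr0.trans_lt hr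
  have hdisc : 0 < A ^ 2 - 8 * L * (1 - m) := by
    have h1 := pow_lt_pow_left₀ hr hr0 two_ne_zero
    rw [mul_pow, Real.sq_sqrt (by positivity)] at h1
    have h2 : (2 * L) ^ 2 * (2 * (1 - m) / L) = 8 * L * (1 - m) := by
      field_simp
      ring
    linarith
  have hs : 0 < √(A ^ 2 - 8 * L * (1 - m)) := Real.sqrt_pos.2 hdisc
  have hs2 := Real.sq_sqrt hdisc.le
  set r := √(A ^ 2 - 8 * L * (1 - m))
  have hLk : 0 < L * (1 - m) := mul_pos hL hk
  have hrA : r < A := lt_of_pow_lt_pow_left₀ 2 hAp.le (by linarith)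
  refine ⟨div_pos (by linarith) (by positivity), ?_, ?_, ?_⟩
  · gcongr
    linarith
  · field_simp
    ring
  · field_simp
    linarith

theorem hasDerivAt_Phi {m s w' : ℝ} {w : ℝ → ℝ} (hw : HasDerivAt w w' s) (hw1 : -1 < w s) :
    HasDerivAt (Phi m w) (1 / m * ((1 + w s) ^ (1 / m - 1) - 1) * w') s := by
  have h := (((hw.const_add 1).rpow_const (p := 1 / m)
    (Or.inl (by linarith : (1 : ℝ) + w s ≠ 0))).sub_const 1).sub (hw.div_const m)
  exact h.congr_deriv (by ring)

/-- Decay estimate, sign behavior and integral finiteness for the solution `w` of the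
linearized ODE (Lemma on `w`). -/
theorem w_decay_and_sign (n : ℕ) (m β : ℝ) (hn : 3 ≤ n) (hm0 : 0 < m)
    (hm1 : m < ((n : ℝ) - 2) / n) (hβ : beta0 n m < β)
    (w : ℝ → ℝ) (hw1 : ∀ s, -1 < w s) (hw2 : ContDiff ℝ 2 w)
    (hode : ∀ s : ℝ,
      deriv (deriv w) s +
        (((n : ℝ) - 2 - ((n : ℝ) + 2) * m) / (1 - m) +
          β * Cstar n m / m * (1 + w s) ^ ((1 - m) / m)) * deriv w s +
        2 * m * ((n : ℝ) - 2 - n * m) / (1 - m) ^ 2 *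
          ((1 + w s) ^ (1 / m) - 1 - w s) = 0)
    (hbot : Tendsto w atBot (nhds (-1))) (htop : Tendsto w atTop (nhds 0)) :
    (∃ C : ℝ, 0 < C ∧ ∀ s : ℝ, |w s| ≤ C * Real.exp (-gamma1 n m β * s)) ∧
    (0 < Acoef1 n m β → ∀ s : ℝ, w s < 0) ∧
    (Acoef1 n m β < 0 → ∃ sStar : ℝ, ∀ s, sStar ≤ s → 0 < w s) ∧
    (Acoef1 n m β ≠ 0 →
      Integrable (fun t : ℝ => Real.exp (gamma1 n m β * t) * Phi m w t) ∧
      0 < ∫ t : ℝ, Real.exp (gamma1 n m β * t) * Phi m w t) ∧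
    (Acoef1 n m β = 0 → Acoef2 n m β < 0 →
      (∀ s : ℝ, w s < 0) ∧
      Integrable (fun t : ℝ => Real.exp (gamma2 n m β * t) * Phi m w t) ∧
      0 < ∫ t : ℝ, Real.exp (gamma2 n m β * t) * Phi m w t) := by
  have hn0 : (0 : ℝ) < n := by positivity
  have hL : 0 < (n : ℝ) - 2 - n * m := by
    rw [lt_div_iff₀ hn0] at hm1
    linarith
  have hk : 0 < 1 - m := by
    have : ((n : ℝ) - 2) / n < 1 := by rw [div_lt_one hn0]; linarith
    linarith
  obtain ⟨hg₁, hg, hsum, hprod⟩ := gamma_roots hL hk ((le_max_left _ _).trans_lt hβ)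
  have hβ0 : 0 < β := (div_pos hm0 hL).trans ((le_max_right _ _).trans_lt hβ)
  have hp : 1 < 1 / m := by rw [lt_div_iff₀ hm0]; linarith
  have hC : 0 < Cstar n m := by unfold Cstar; positivity
  have hw : ∀ s, HasDerivAt w (deriv w s) s := fun s =>
    (hw2.differentiable (by norm_num) s).hasDerivAt
  have hv : ∀ s, HasDerivAt (deriv w) (deriv (deriv w) s) s := fun s =>
    ((hw2.iterate_deriv' 1 1).differentiable (by norm_num) s).hasDerivAt
  have hΦ : ∀ s, HasDerivAt (Phi m w) _ s := fun s => hasDerivAt_Phi (hw s) (hw1 s)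
  have hz : ∀ g g', g + g' = A0 n m β / (1 - m) →
      g * g' = 2 * ((n : ℝ) - 2 - n * m) / (1 - m) → ∀ s,
      HasDerivAt (fun t => deriv w t + (g' * w t + β * Cstar n m * Phi m w t))
        (-g * (deriv w s + (g' * w s + β * Cstar n m * Phi m w s)) +
          -(Cstar n m * (1 / (1 - m) - β * g)) * Phi m w s) s := by
    intro g g' h1 h2 s
    refine ((hv s).add (((hw s).const_mul g').add ((hΦ s).const_mul _))).congr_deriv ?_
    have h3 := hode s
    rw [show (1 - m) / m = 1 / m - 1 by field_simp] at h3
    have e₁ : A0 n m β / (1 - m) =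
        ((n : ℝ) - 2 - ((n : ℝ) + 2) * m) / (1 - m) + β * Cstar n m / m := by
      unfold A0 Cstar
      field_simp
    have e₂ : 2 * ((n : ℝ) - 2 - n * m) / (1 - m) =
        Cstar n m / (1 - m) / m - Cstar n m / (1 - m) := by
      unfold Cstar
      field_simp
    have e₃ : 2 * m * ((n : ℝ) - 2 - n * m) / (1 - m) ^ 2 = Cstar n m / (1 - m) := by
      unfold Cstar
      field_simp
    rw [e₃] at h3
    rw [Phi]
    linear_combination h3 + deriv w s * (h1.trans e₁) + w s * (h2.trans e₂)
  obtain ⟨K, hK0, hK⟩ := exists_rpow_one_add_sub_le_mul_sq hp.le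
  have hΦbot : Tendsto (Phi m w) atBot (𝓝 ((1 + -1) ^ (1 / m) - 1 - -1 / m)) :=
    (((hbot.const_add 1).rpow_const (Or.inr (by positivity))).sub_const 1).sub (hbot.div_const m)
  obtain ⟨hdecay, hneg, hpos, hI₁, hI₂⟩ := decay_and_sign_of_system hg₁ hg (by positivity) hw
    (hz _ _ hsum hprod) (hz _ _ ((add_comm _ _).trans hsum) ((mul_comm _ _).trans hprod))
    (continuous_iff_continuousAt.2 fun s => (hΦ s).continuousAt)
    (fun s => by
      have := one_add_mul_self_le_rpow_one_add (hw1 s).le hp.le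
      rw [Phi]
      linarith [one_div_mul_eq_div m (w s)])
    (fun s hs => by
      have := one_add_mul_self_lt_rpow_one_add (hw1 s).le hs hp
      rw [Phi]
      linarith [one_div_mul_eq_div m (w s)])
    hK0.le ((htop.eventually hK).mono fun s hs => by
      rw [Phi]
      linarith [one_div_mul_eq_div m (w s)])
    hbot hΦbot htop
  refine ⟨hdecay, fun h => hneg (mul_pos hC h).le, fun h => hpos (mul_neg_of_pos_of_neg hC h),
    fun _ => hI₁, fun h _ => ?_⟩
  have h0 : Cstar n m * (1 / (1 - m) - β * gamma1 n m β) = 0 := by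
    rw [← Acoef1, h, mul_zero]
  exact ⟨hneg h0.ge, hI₂ h0⟩
end

section
/- Suppose either condition (C1) or condition (C3) holds. Then for every λ > 0 the self-similar profile f_λ satisfies f_λ(r) < (C_*/r²)^{1/(1-m)} for all r > 0. -/
open Real Filter MeasureTheory Set Topology

/-- An integrating-factor form of Grönwall's inequality. -/
lemma mul_exp_le_of_mul_le_deriv {Z Z' : ℝ → ℝ} {K a b : ℝ} (hab : a ≤ b)
    (hc : ContinuousOn Z (Icc a b)) (hd : ∀ x ∈ Ioo a b, HasDerivAt Z (Z' x) x)
    (h : ∀ x ∈ Ioo a b, K * Z x ≤ Z' x) :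
    Z a * exp (-(K * a)) ≤ Z b * exp (-(K * b)) := by
  have hE : ∀ x : ℝ, HasDerivAt (fun x => exp (-(K * x))) (exp (-(K * x)) * (-(K * 1))) x :=
    fun x => (((hasDerivAt_id x).const_mul K).neg).exp
  have hmono : MonotoneOn (fun x => Z x * exp (-(K * x))) (Icc a b) := by
    refine monotoneOn_of_hasDerivWithinAt_nonneg (convex_Icc a b)
      (f' := fun x => Z' x * exp (-(K * x)) + Z x * (exp (-(K * x)) * (-(K * 1)))) ?_ ?_ ?_
    · exact hc.mul (by fun_prop)
    · intro x hx
      rw [interior_Icc] at hx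
      exact ((hd x hx).mul (hE x)).hasDerivWithinAt
    · intro x hx
      rw [interior_Icc] at hx
      have h1 := mul_nonneg (sub_nonneg.2 (h x hx)) (exp_pos (-(K * x))).le
      linarith
  exact hmono (left_mem_Icc.2 hab) (right_mem_Icc.2 hab) hab

/-- A function that starts nonnegative and satisfies `K * Z ≤ Z'` wherever it is negative
remains nonnegative. -/
lemma nonneg_of_mul_le_deriv_of_neg {Z Z' : ℝ → ℝ} {K a b : ℝ}
    (hc : ContinuousOn Z (Icc a b)) (ha : 0 ≤ Z a)
    (hd : ∀ x ∈ Ioo a b, HasDerivAt Z (Z' x) x)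
    (h : ∀ x ∈ Ioo a b, Z x < 0 → K * Z x ≤ Z' x) : ∀ x ∈ Icc a b, 0 ≤ Z x := by
  intro x₁ hx₁
  by_contra! hneg
  have hsub : Icc a x₁ ⊆ Icc a b := Icc_subset_Icc_right hx₁.2
  have hclosed : IsClosed (Icc a x₁ ∩ Z ⁻¹' Ici 0) :=
    (hc.mono hsub).preimage_isClosed_of_isClosed isClosed_Icc isClosed_Ici
  have hcomp : IsCompact (Icc a x₁ ∩ Z ⁻¹' Ici 0) :=
    isCompact_Icc.of_isClosed_subset hclosed inter_subset_left
  obtain ⟨x₂, ⟨hx₂, hZ₂⟩, hmax⟩ :=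
    hcomp.exists_isGreatest ⟨a, left_mem_Icc.2 hx₁.1, ha⟩
  have hneg' : ∀ x ∈ Ioo x₂ x₁, Z x < 0 := by
    intro x hx
    by_contra! hx0
    exact absurd (hmax ⟨⟨hx₂.1.trans hx.1.le, hx.2.le⟩, hx0⟩) (not_le.2 hx.1)
  have hIoo : Ioo x₂ x₁ ⊆ Ioo a b := Ioo_subset_Ioo hx₂.1 hx₁.2
  have key := mul_exp_le_of_mul_le_deriv hx₂.2
    (hc.mono (Icc_subset_Icc hx₂.1 hx₁.2)) (fun x hx => hd x (hIoo hx))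
    (fun x hx => h x (hIoo hx) (hneg' x hx))
  have h1 : 0 ≤ Z x₂ * exp (-(K * x₂)) := mul_nonneg hZ₂ (exp_pos _).le
  have h2 : Z x₁ * exp (-(K * x₁)) < 0 := mul_neg_of_neg_of_pos hneg (exp_pos _)
  linarith

/-- Logarithmic-variable form of the equation: with `y = r² f^{1-m} / C` and `p = (1-m) r f' / f`,
one has `r y' = y (2 + p)` and `r p' = -(c p² + (N-2) p + D y (1 + β (2 + p)))`.  If `γ ≥ 2` and
`γ² - (N - 2 - 4c + Dβ) γ + D ≤ 0`, then `y < 1`. -/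
lemma lt_one_of_log_system {y p y' p' : ℝ → ℝ} {N c D β γ K : ℝ}
    (hN : 2 ≤ N) (hc : 0 < c) (hD : 0 < D) (hβ : 0 < β)
    (hbal : 4 * c - 2 * (N - 2) + D = 0)
    (hγ : 2 ≤ γ) (hquad : γ ^ 2 - (N - 2 - 4 * c + D * β) * γ + D ≤ 0)
    (hyc : ContinuousOn y (Ici 0)) (hpc : ContinuousOn p (Ici 0))
    (hy0 : y 0 = 0) (hp0 : p 0 = 0) (R : ℝ) (hypos : ∀ r, 0 < r → 0 < y r)
    (hyK : ∀ r ∈ Ioo 0 R, y r ≤ K * r)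
    (hyd : ∀ r, 0 < r → HasDerivAt y (y' r) r) (hpd : ∀ r, 0 < r → HasDerivAt p (p' r) r)
    (hy : ∀ r, 0 < r → r * y' r = y r * (2 + p r))
    (hp : ∀ r, 0 < r → r * p' r =
      -(c * p r ^ 2 + (N - 2) * p r + D * y r * (1 + β * (2 + p r))))
    (hR : 0 < R) : y R < 1 := by
  by_contra! hyR
  have hsubR : Icc 0 R ⊆ Ici (0 : ℝ) := Icc_subset_Ici_self
  have hclosed : IsClosed (Icc 0 R ∩ y ⁻¹' Ici 1) :=
    (hyc.mono hsubR).preimage_isClosed_of_isClosed isClosed_Icc isClosed_Ici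
  have hcomp : IsCompact (Icc 0 R ∩ y ⁻¹' Ici 1) :=
    isCompact_Icc.of_isClosed_subset hclosed inter_subset_left
  obtain ⟨r₀, ⟨hr₀, hy₀⟩, hmin⟩ := hcomp.exists_isLeast ⟨R, right_mem_Icc.2 hR.le, hyR⟩
  have hylt : ∀ r ∈ Ioo 0 r₀, y r < 1 := by
    intro r hr
    by_contra! h1
    exact absurd (hmin ⟨⟨hr.1.le, hr.2.le.trans hr₀.2⟩, h1⟩) (not_le.2 hr.2)
  have hsub₀ : Icc 0 r₀ ⊆ Ici (0 : ℝ) := Icc_subset_Ici_self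
  have hZ : ∀ r ∈ Icc 0 r₀, 0 ≤ γ * (1 - y r) - 2 - p r := by
    refine nonneg_of_mul_le_deriv_of_neg (Z := fun r => γ * (1 - y r) - 2 - p r)
      (Z' := fun r => γ * (-y' r) - p' r) (K := (γ + 2 * c * γ) * K) ?_ ?_ ?_ ?_
    · have h1 := hyc.mono hsub₀
      have h2 := hpc.mono hsub₀
      fun_prop
    · simp only [hy0, hp0]; linarith
    · intro r hr
      exact ((((hyd r hr.1).const_sub 1).const_mul γ).sub_const 2).sub (hpd r hr.1)
    · intro r hr hneg
      have hr0 : 0 < r := hr.1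
      have e1 := hy r hr0
      have e2 := hp r hr0
      have hyp := hypos r hr0
      have hy1 := hylt r hr
      have hyk := hyK r ⟨hr.1, hr.2.trans_le hr₀.2⟩
      set Y := y r
      set Z := γ * (1 - Y) - 2 - p r with hZdef
      have hpZ : p r = γ * (1 - Y) - 2 - Z := by rw [hZdef]; ring
      set q0 := c * (γ - 2) ^ 2 + (N - 2) * (γ - 2) with hq0
      have hq0n : 0 ≤ q0 := by
        have : 0 ≤ (N - 2) * (γ - 2) := mul_nonneg (by linarith) (by linarith)
        positivity
      set q1 := -γ ^ 2 * (1 + c) + D * β * γ with hq1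
      have hq01 : 0 ≤ q0 + q1 := by rw [hq0, hq1]; nlinarith
      have hQ : 0 ≤ (1 - Y) * (q0 + q1 * Y) := by
        refine mul_nonneg (by linarith) ?_
        have : q0 + q1 * Y = q0 * (1 - Y) + (q0 + q1) * Y := by ring
        rw [this]
        exact add_nonneg (mul_nonneg hq0n (by linarith)) (mul_nonneg hq01 hyp.le)
      have hexp : r * (γ * (-y' r) - p' r) = (1 - Y) * (q0 + q1 * Y)
          + (γ * Y - 2 * c * (γ * (1 - Y) - 2) - (N - 2) - D * β * Y) * Z + c * Z ^ 2 := by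
        have hD' : D = 2 * (N - 2) - 4 * c := by linarith
        have : r * (γ * (-y' r) - p' r) = -γ * (r * y' r) - r * p' r := by ring
        rw [this, e1, e2, hpZ, hq0, hq1, hD']
        ring
      have hL : (γ + 2 * c * γ) * K * r ≥
          γ * Y - 2 * c * (γ * (1 - Y) - 2) - (N - 2) - D * β * Y := by
        have h1 : (γ + 2 * c * γ) * Y ≤ (γ + 2 * c * γ) * (K * r) :=
          mul_le_mul_of_nonneg_left hyk (by positivity)
        have h2 : 0 ≤ D * β * Y := by positivity
        have h3 : 0 ≤ c * (γ - 2) := mul_nonneg hc.le (by linarith)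
        nlinarith
      have hfin : r * ((γ + 2 * c * γ) * K * Z) ≤ r * (γ * (-y' r) - p' r) := by
        rw [hexp]
        have h1 := mul_le_mul_of_nonpos_right hL hneg.le
        have h2 : 0 ≤ c * Z ^ 2 := by positivity
        linarith
      exact le_of_mul_le_mul_left hfin hr0
  have key := mul_exp_le_of_mul_le_deriv (Z := fun r => 1 - y r) (Z' := fun r => -y' r)
    (K := -(γ * K)) hr₀.1 (continuousOn_const.sub (hyc.mono hsub₀))
    (fun r hr => (hyd r hr.1).const_sub 1) (by
      intro r hr
      have hr0 : 0 < r := hr.1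
      have e1 := hy r hr0
      have hyp := hypos r hr0
      have hy1 := hylt r hr
      have hyk := hyK r ⟨hr.1, hr.2.trans_le hr₀.2⟩
      have hz := hZ r ⟨hr.1.le, hr.2.le⟩
      have h1 : r * y' r ≤ y r * (γ * (1 - y r)) := by
        rw [e1]; exact mul_le_mul_of_nonneg_left (by linarith) hyp.le
      have h2 : y r * (γ * (1 - y r)) ≤ (K * r) * (γ * (1 - y r)) :=
        mul_le_mul_of_nonneg_right hyk (mul_nonneg (by linarith) (by linarith))
      refine le_of_mul_le_mul_left ?_ hr0
      linarith)
  have h0 : 0 < (1 - y 0) * exp (-(-(γ * K) * 0)) := by rw [hy0]; positivity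
  have h1 : (1 - y r₀) * exp (-(-(γ * K) * r₀)) ≤ 0 :=
    mul_nonpos_of_nonpos_of_nonneg (sub_nonpos.2 hy₀) (exp_pos _).le
  linarith

/-- Under (C1) or (C3) there is a rate `γ ≥ 2` between the two decay rates of the linearization
at the singular profile. -/
lemma exists_barrier_rate {n : ℕ} {m β : ℝ} (hm : m < 1) (hν : 0 < (n : ℝ) - 2 - n * m)
    (hcond : CondC1 n m β ∨ CondC3 n m β) :
    ∃ γ : ℝ, 2 ≤ γ ∧ γ ^ 2 - A0 n m β / (1 - m) * γ
      + 2 * ((n : ℝ) - 2 - n * m) / (1 - m) ≤ 0 := by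
  have hm' : 0 < 1 - m := by linarith
  have hbig : beta1 n m ≤ β → ∃ γ : ℝ, 2 ≤ γ ∧ γ ^ 2 - A0 n m β / (1 - m) * γ
      + 2 * ((n : ℝ) - 2 - n * m) / (1 - m) ≤ 0 := by
    intro h
    refine ⟨2, le_rfl, ?_⟩
    rw [beta1, div_le_iff₀ hν] at h
    have : (2 : ℝ) ^ 2 - A0 n m β / (1 - m) * 2 + 2 * ((n : ℝ) - 2 - n * m) / (1 - m)
        = 4 * (1 - β * ((n : ℝ) - 2 - n * m)) / (1 - m) := by
      rw [A0]; field_simp; ring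
    rw [this]
    exact div_nonpos_of_nonpos_of_nonneg (by linarith) hm'.le
  rcases hcond with (h | ⟨hn, -, hmn, h0, -⟩) | ⟨h, -⟩
  · exact hbig h.le
  · have hn' : (4 : ℝ) < n := by exact_mod_cast hn
    rw [lt_div_iff₀ (by linarith)] at hmn
    have hβ2 : beta2 n m < β := (le_max_left _ _).trans_lt h0
    set ν := (n : ℝ) - 2 - n * m with hνdef
    set D := 2 * ν / (1 - m) with hD
    have hD4 : 4 ≤ D := by
      rw [hD, le_div_iff₀ hm']; linarith
    have hsq : sqrt D ^ 2 = D := sq_sqrt (by linarith)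
    have hs : sqrt (2 * (1 - m) / ν) = sqrt D * (1 - m) / ν := by
      rw [sqrt_eq_iff_mul_self_eq_of_pos (by positivity), ← sq, div_pow, mul_pow, hsq, hD]
      field_simp
    have hA : 2 * sqrt D ≤ A0 n m β / (1 - m) := by
      rw [le_div_iff₀ hm']
      rw [beta2, ← hνdef, hs, div_add_div _ _ hν.ne' (by positivity),
        div_lt_iff₀ (by positivity)] at hβ2
      rw [A0, ← hνdef]
      have : ν * (sqrt D * (1 - m) * 2 + (((n : ℝ) + 2) * m - (n - 2)))
          ≤ ν * (2 * ν * β) := by linarith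
      have := le_of_mul_le_mul_left this hν
      linarith
    refine ⟨sqrt D, le_sqrt_of_sq_le (by linarith), ?_⟩
    have := mul_le_mul_of_nonneg_right hA (sqrt_nonneg D)
    rw [hsq]
    linarith [sq (sqrt D)]
  · exact hbig h.ge

lemma pos_of_cond {n : ℕ} {m β : ℝ} (hm : 0 < m) (hν : 0 < (n : ℝ) - 2 - n * m)
    (hcond : CondC1 n m β ∨ CondC3 n m β) : 0 < β := by
  have h1 : 0 < beta1 n m := by unfold beta1; positivity
  have he : 0 < betaE n m := by unfold betaE; positivity
  rcases hcond with (h | ⟨-, -, -, h, -⟩) | ⟨h, -⟩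
  · exact h1.trans h
  · exact he.trans ((le_max_right _ _).trans_lt h)
  · exact h ▸ h1

namespace IsProfile

variable {n : ℕ} {m β α lam : ℝ} {f : ℝ → ℝ}

lemma hasDerivAt (hf : IsProfile n m β α lam f) {r : ℝ} (hr : 0 < r) :
    HasDerivAt f (derivWithin f (Ici 0) r) r := by
  have h : ContDiffAt ℝ 2 f r := hf.smooth.contDiffAt (Ici_mem_nhds hr)
  rw [derivWithin_of_mem_nhds (Ici_mem_nhds hr)]
  exact (h.differentiableAt (by norm_num)).hasDerivAt

lemma contDiffOn_derivWithin (hf : IsProfile n m β α lam f) :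
    ContDiffOn ℝ 1 (derivWithin f (Ici 0)) (Ici 0) :=
  hf.smooth.derivWithin (uniqueDiffOn_Ici 0) (by norm_num)

lemma hasDerivAt_derivWithin (hf : IsProfile n m β α lam f) {r : ℝ} (hr : 0 < r) :
    HasDerivAt (derivWithin f (Ici 0)) (deriv (derivWithin f (Ici 0)) r) r :=
  ((hf.contDiffOn_derivWithin.contDiffAt (Ici_mem_nhds hr)).differentiableAt
    (by norm_num)).hasDerivAt

/-- The profile equation with the derivatives of `f ^ m` expanded and divided by `f ^ (m - 1)`. -/
lemma ode_expanded (hf : IsProfile n m β α lam f) {r : ℝ} (hr : 0 < r) :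
    m * deriv (derivWithin f (Ici 0)) r + m * (m - 1) * derivWithin f (Ici 0) r ^ 2 / f r
      + (n - 1) / r * m * derivWithin f (Ici 0) r
      + (α * f r + β * r * derivWithin f (Ici 0) r) * f r ^ (1 - m) = 0 := by
  have hfr := hf.pos r hr.le
  have hfm : ∀ s, 0 < s → HasDerivAt (fun s => f s ^ m)
      (derivWithin f (Ici 0) s * m * f s ^ (m - 1)) s := fun s hs =>
    (hf.hasDerivAt hs).rpow_const (Or.inl (hf.pos s hs.le).ne')
  have hev : deriv (fun s => f s ^ m) =ᶠ[𝓝 r]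
      fun s => derivWithin f (Ici 0) s * m * f s ^ (m - 1) := by
    filter_upwards [Ioi_mem_nhds hr] with s hs using (hfm s hs).deriv
  have h2 := ((hf.hasDerivAt_derivWithin hr).mul_const m).mul
    ((hf.hasDerivAt hr).rpow_const (p := m - 1) (Or.inl hfr.ne'))
  have hode := hf.ode r hr
  rw [hev.deriv_eq, (hfm r hr).deriv, (hf.hasDerivAt hr).deriv] at hode
  have h2' := h2.deriv
  simp only [Pi.mul_def] at h2'
  rw [h2'] at hode
  have e1 : f r ^ (m - 1) * f r ^ (1 - m) = 1 := by
    rw [← rpow_add hfr]; simp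
  have e2 : f r ^ (m - 1 - 1) * f r ^ (1 - m) = (f r)⁻¹ := by
    rw [← rpow_add hfr, ← rpow_neg_one]; congr 1; ring
  have := congrArg (· * f r ^ (1 - m)) hode
  simp only [zero_mul] at this
  rw [div_eq_mul_inv _ (f r), ← e2]
  linear_combination this + (-(m * deriv (derivWithin f (Ici 0)) r)
    - (n - 1) / r * m * derivWithin f (Ici 0) r) * e1

end IsProfile

/-- Under (C1) or (C3), every self-similar profile lies strictly below the singular profile. -/
theorem profile_below_singular (n : ℕ) (m β α : ℝ) (hn : 3 ≤ n) (hm0 : 0 < m)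
    (hm1 : m < ((n : ℝ) - 2) / n) (hα : α = (2 * β + 1) / (1 - m))
    (hcond : CondC1 n m β ∨ CondC3 n m β)
    (f : ℝ → ℝ → ℝ) (hf : ∀ lam, 0 < lam → IsProfile n m β α lam (f lam)) :
    ∀ lam, 0 < lam → ∀ r : ℝ, 0 < r → f lam r < (Cstar n m / r ^ 2) ^ (1 / (1 - m)) := by
  intro lam hlam R hR
  have hprof := hf lam hlam
  generalize f lam = g at hprof
  have hn' : (3 : ℝ) ≤ n := by exact_mod_cast hn
  have hν : 0 < (n : ℝ) - 2 - n * m := by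
    rw [lt_div_iff₀ (by linarith)] at hm1
    linarith
  have hm : m < 1 := hm1.trans_le (by rw [div_le_one (by linarith)]; linarith)
  have hm' : 0 < 1 - m := by linarith
  have hC : 0 < Cstar n m := by unfold Cstar; positivity
  have hβ := pos_of_cond hm0 hν hcond
  obtain ⟨γ, hγ, hquad⟩ := exists_barrier_rate hm hν hcond
  set g₁ := derivWithin g (Ici 0) with hg₁
  have hgc : ContinuousOn g (Ici 0) := hprof.smooth.continuousOn
  have hg₁c : ContinuousOn g₁ (Ici 0) := hprof.contDiffOn_derivWithin.continuousOn
  have hqc : ContinuousOn (fun r => g r ^ (1 - m)) (Ici 0) :=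
    hgc.rpow_const fun r hr => Or.inl (hprof.pos r hr).ne'
  obtain ⟨B, hB⟩ := isCompact_Icc.bddAbove_image
    ((continuousOn_id.mul (hqc.div_const (Cstar n m))).mono (Icc_subset_Ici_self : Icc 0 R ⊆ Ici (0 : ℝ)))
  have hlt : R ^ 2 * g R ^ (1 - m) / Cstar n m < 1 := by
    refine lt_one_of_log_system (y := fun r => r ^ 2 * g r ^ (1 - m) / Cstar n m)
      (p := fun r => (1 - m) * (r * g₁ r / g r))
      (y' := fun r => (2 * r * g r ^ (1 - m)
        + r ^ 2 * (g₁ r * (1 - m) * g r ^ (1 - m - 1))) / Cstar n m)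
      (p' := fun r => (1 - m) * (((1 * g₁ r + r * deriv g₁ r) * g r - r * g₁ r * g₁ r) / g r ^ 2))
      (N := n) (c := m / (1 - m)) (D := 2 * ((n : ℝ) - 2 - n * m) / (1 - m)) (β := β) (γ := γ)
      (K := B) (by linarith) (by positivity) (by positivity) hβ ?_ hγ ?_ ?_ ?_ ?_ ?_ R
      ?_ ?_ ?_ ?_ ?_ ?_ hR
    · field_simp
      ring
    · convert hquad using 4
      rw [A0]
      field_simp
      ring
    · exact ((continuousOn_id.pow 2).mul hqc).div_const _
    · exact continuousOn_const.mul ((continuousOn_id.mul hg₁c).div hgc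
        fun r hr => (hprof.pos r hr).ne')
    · simp
    · simp
    · intro r hr
      have := rpow_pos_of_pos (hprof.pos r hr.le) (1 - m)
      positivity
    · intro r hr
      have h1 : r * (g r ^ (1 - m) / Cstar n m) ≤ B :=
        hB (mem_image_of_mem _ ⟨hr.1.le, hr.2.le⟩)
      have h2 := mul_le_mul_of_nonneg_right h1 hr.1.le
      calc r ^ 2 * g r ^ (1 - m) / Cstar n m = r * (g r ^ (1 - m) / Cstar n m) * r := by ring
        _ ≤ B * r := h2
    · intro r hr
      have h1 := (hprof.hasDerivAt hr).rpow_const (p := 1 - m)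
        (Or.inl (hprof.pos r hr.le).ne')
      have h2 : HasDerivAt (fun r : ℝ => r ^ 2) (2 * r) r := by
        simpa using hasDerivAt_pow 2 r
      exact (h2.mul h1).div_const _
    · intro r hr
      exact ((((hasDerivAt_id r).mul (hprof.hasDerivAt_derivWithin hr)).div
        (hprof.hasDerivAt hr) (hprof.pos r hr.le).ne').const_mul (1 - m))
    · intro r hr
      have hgr := hprof.pos r hr.le
      rw [rpow_sub_one hgr.ne']
      field_simp
    · intro r hr
      have hgr := hprof.pos r hr.le
      have hode := hprof.ode_expanded hr
      rw [← hg₁, hα] at hode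
      generalize g r ^ (1 - m) = q at *
      generalize deriv g₁ r = g₂ at *
      rw [Cstar]
      have h2 : g₂ = -((m - 1) * g₁ r ^ 2 / g r + (n - 1) / r * g₁ r
          + ((2 * β + 1) / (1 - m) * g r + β * r * g₁ r) * q / m) := by
        have hmne := hm0.ne'
        field_simp at hode ⊢
        linarith
      obtain ⟨ν, hνdef⟩ : ∃ ν, ν = (n : ℝ) - 2 - n * m := ⟨_, rfl⟩
      have hνne : ν ≠ 0 := hνdef ▸ hν.ne'
      rw [h2, ← hνdef]
      field_simp
      ring
  have hlt' : g R ^ (1 - m) < Cstar n m / R ^ 2 := by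
    rw [div_lt_one hC] at hlt
    rw [lt_div_iff₀ (by positivity)]
    linarith
  have hgR := hprof.pos R hR.le
  have := rpow_lt_rpow (rpow_nonneg hgR.le _) hlt' (one_div_pos.2 hm')
  rwa [← rpow_mul hgR.le, mul_one_div_cancel hm'.ne', rpow_one] at this
end
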